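/- arXiv:math/0405006 — 12 statements merged into one kernel-verified Lean document; each statement's English description precedes it below -/
import Mathlib

section
/- Let h : X → ℝ be a function and C ≥ 0 a real number such that |∑_{i=1}^k h(fᵢ(x)) − d·h(x)| ≤ C for all x ∈ X. Then there exists a function ĥ : X → ℝ such that (i) |ĥ(x) − h(x)| ≤ C/(d−k) for all x ∈ X, and (ii) ∑_{i=1}^k ĥ(fᵢ(x)) = d·ĥ(x) for all x ∈ X. -/
/-- Existence part of the canonical height (Theorem 1.2.1):
given a height `h` with `|∑ᵢ h(fᵢ x) - d·h x| ≤ C`, there is a canonical height `hhat`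
with `|hhat - h| ≤ C/(d-k)` satisfying the functional equation `∑ᵢ hhat(fᵢ x) = d·hhat x`. -/
theorem canonical_height_exists {X : Type*} {k : ℕ} (hk : 1 ≤ k) (f : Fin k → X → X)
    (d : ℝ) (hd : (k : ℝ) < d) (h : X → ℝ) (C : ℝ) (hC : 0 ≤ C)
    (hbound : ∀ x : X, |(∑ i : Fin k, h (f i x)) - d * h x| ≤ C) :
    ∃ hhat : X → ℝ, (∀ x : X, |hhat x - h x| ≤ C / (d - k)) ∧
      (∀ x : X, ∑ i : Fin k, hhat (f i x) = d * hhat x) := by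
  have hk0 : (0 : ℝ) ≤ k := Nat.cast_nonneg k
  have hd0 : 0 < d := lt_of_le_of_lt hk0 hd
  let a : ℕ → X → ℝ := fun n => Nat.rec h (fun _ g x => (∑ i : Fin k, g (f i x)) / d) n
  have ha0 : ∀ x, a 0 x = h x := fun x => rfl
  have haS : ∀ n x, a (n + 1) x = (∑ i : Fin k, a n (f i x)) / d := fun n x => rfl
  clear_value a
  have hstep : ∀ n x, dist (a n x) (a (n + 1) x) ≤ C / d * ((k : ℝ) / d) ^ n := by
    intro n
    induction n with
    | zero =>
      intro x
      rw [dist_comm, Real.dist_eq, haS]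
      simp only [ha0, pow_zero, mul_one]
      have e : (∑ i : Fin k, h (f i x)) / d - h x
          = ((∑ i : Fin k, h (f i x)) - d * h x) / d := by field_simp
      rw [e, abs_div, abs_of_pos hd0]
      exact div_le_div_of_nonneg_right (hbound x) hd0.le
    | succ n ih =>
      intro x
      rw [Real.dist_eq, haS n, haS (n + 1), ← sub_div, ← Finset.sum_sub_distrib, abs_div,
        abs_of_pos hd0]
      have h1 : |∑ i : Fin k, (a n (f i x) - a (n + 1) (f i x))|
          ≤ k * (C / d * ((k : ℝ) / d) ^ n) := by
        refine (Finset.abs_sum_le_sum_abs _ _).trans ?_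
        refine (Finset.sum_le_sum fun i _ => ih (f i x)).trans ?_
        simp
      calc _ ≤ k * (C / d * ((k : ℝ) / d) ^ n) / d := div_le_div_of_nonneg_right h1 hd0.le
        _ = _ := by rw [pow_succ]; ring
  have hr : (k : ℝ) / d < 1 := (div_lt_one hd0).2 hd
  have hlim : ∀ x, ∃ l, Filter.Tendsto (fun n => a n x) Filter.atTop (nhds l) := fun x =>
    cauchySeq_tendsto_of_complete
      (cauchySeq_of_le_geometric _ _ hr fun n => hstep n x)
  choose g hg using hlim
  refine ⟨g, fun x => ?_, fun x => ?_⟩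
  · have := dist_le_of_le_geometric_of_tendsto₀ _ _ hr (fun n => hstep n x) (hg x)
    rw [dist_comm, Real.dist_eq, ha0] at this
    refine this.trans (le_of_eq ?_)
    have : d - k ≠ 0 := (sub_pos.2 hd).ne'
    have e : 1 - (k : ℝ) / d = (d - k) / d := by field_simp
    rw [e]
    field_simp
  · have h1 : Filter.Tendsto (fun n => a (n + 1) x) Filter.atTop (nhds (g x)) :=
      (hg x).comp (Filter.tendsto_add_atTop_nat 1)
    have h2 : Filter.Tendsto (fun n => a (n + 1) x) Filter.atTop
        (nhds ((∑ i : Fin k, g (f i x)) / d)) := by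
      simp only [haS]
      exact (tendsto_finsetSum _ fun i _ => hg (f i x)).div_const d
    have := tendsto_nhds_unique h1 h2
    rw [this]
    field_simp
end

section
/- Let h : X → ℝ be a function and C ≥ 0 a real number such that |∑_{i=1}^k h(fᵢ(x)) − d·h(x)| ≤ C for all x ∈ X. For l ∈ ℕ and x ∈ X set a_l(x) := (1/dˡ) · ∑_{w ∈ {1,…,k}ˡ} h(f_w(x)). Then |a_{l+1}(x) − a_l(x)| ≤ kˡ·C/d^{l+1} for every l and x, and for every x ∈ X the sequence (a_l(x))_{l≥0} converges (to a real limit). -/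
/-- `applyWord f w x` is `f_{i₁} ∘ ⋯ ∘ f_{i_l}` applied to `x` for the word `w = (i₁, …, i_l)`. -/
def applyWord {X : Type*} {k : ℕ} (f : Fin k → X → X) : List (Fin k) → X → X
  | [], x => x
  | i :: w, x => f i (applyWord f w x)

/-- `aSeq f d h l x = (1/dˡ) ∑_{w ∈ {1,…,k}ˡ} h (f_w x)`. -/
noncomputable def aSeq {X : Type*} {k : ℕ} (f : Fin k → X → X) (d : ℝ) (h : X → ℝ)
    (l : ℕ) (x : X) : ℝ :=
  (1 / d ^ l) * ∑ w : Fin l → Fin k, h (applyWord f (List.ofFn w) x)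

/-- Cauchy estimate and convergence of the sequence `a_l(x)` (proof of Theorem 1.2.1). -/
theorem aSeq_estimate_and_converges {X : Type*} {k : ℕ} (hk : 1 ≤ k) (f : Fin k → X → X)
    (d : ℝ) (hd : (k : ℝ) < d) (h : X → ℝ) (C : ℝ) (hC : 0 ≤ C)
    (hbound : ∀ x : X, |(∑ i : Fin k, h (f i x)) - d * h x| ≤ C) :
    (∀ (l : ℕ) (x : X),
      |aSeq f d h (l + 1) x - aSeq f d h l x| ≤ (k : ℝ) ^ l * C / d ^ (l + 1)) ∧
    (∀ x : X, ∃ L : ℝ, Filter.Tendsto (fun l => aSeq f d h l x) Filter.atTop (nhds L)) := by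
  have hk0 : (0:ℝ) ≤ k := Nat.cast_nonneg k
  have hd0 : 0 < d := lt_of_le_of_lt hk0 hd
  have key : ∀ (l : ℕ) (x : X),
      |aSeq f d h (l + 1) x - aSeq f d h l x| ≤ (k : ℝ) ^ l * C / d ^ (l + 1) := by
    intro l x
    have e1 : ∑ w : Fin (l + 1) → Fin k, h (applyWord f (List.ofFn w) x)
        = ∑ w : Fin l → Fin k, ∑ i : Fin k, h (f i (applyWord f (List.ofFn w) x)) := by
      rw [← (Fin.consEquiv (fun _ : Fin (l + 1) => Fin k)).sum_comp, Fintype.sum_prod_type,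
        Finset.sum_comm]
      refine Finset.sum_congr rfl fun w _ => Finset.sum_congr rfl fun i _ => ?_
      simp [Fin.consEquiv, List.ofFn_succ, applyWord]
    have e2 : aSeq f d h (l + 1) x - aSeq f d h l x
        = (∑ w : Fin l → Fin k, ((∑ i : Fin k, h (f i (applyWord f (List.ofFn w) x)))
            - d * h (applyWord f (List.ofFn w) x))) / d ^ (l + 1) := by
      unfold aSeq
      rw [e1, Finset.sum_sub_distrib, ← Finset.mul_sum]
      field_simp
      ring
    rw [e2, abs_div, abs_of_pos (pow_pos hd0 (l + 1))]
    gcongr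
    refine (Finset.abs_sum_le_sum_abs _ _).trans ?_
    refine (Finset.sum_le_sum fun w _ => hbound _).trans ?_
    simp
  refine ⟨key, fun x => ?_⟩
  have hr : (k : ℝ) / d < 1 := (div_lt_one hd0).2 hd
  refine cauchySeq_tendsto_of_complete (cauchySeq_of_le_geometric ((k : ℝ) / d) (C / d) hr ?_)
  intro l
  rw [dist_comm, Real.dist_eq]
  refine (key l x).trans (le_of_eq ?_)
  rw [div_pow, pow_succ]
  field_simp
end

section
/- Suppose ĥ₁, ĥ₂ : X → ℝ both satisfy ∑_{i=1}^k ĥⱼ(fᵢ(x)) = d·ĥⱼ(x) for all x ∈ X (j = 1, 2), and suppose there is a constant C′ ≥ 0 with |ĥ₁(x) − ĥ₂(x)| ≤ C′ for all x ∈ X. Then ĥ₁ = ĥ₂. -/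
/-- Uniqueness part of Theorem 1.2.1: two functions satisfying the functional equation
and differing by a bounded amount coincide. -/
theorem canonical_height_unique {X : Type*} {k : ℕ} (hk : 1 ≤ k) (f : Fin k → X → X)
    (d : ℝ) (hd : (k : ℝ) < d) (hhat1 hhat2 : X → ℝ)
    (h1 : ∀ x : X, ∑ i : Fin k, hhat1 (f i x) = d * hhat1 x)
    (h2 : ∀ x : X, ∑ i : Fin k, hhat2 (f i x) = d * hhat2 x)
    (C' : ℝ) (hC' : 0 ≤ C') (hbd : ∀ x : X, |hhat1 x - hhat2 x| ≤ C') :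
    hhat1 = hhat2 := by
  have hd0 : 0 < d := lt_of_le_of_lt (Nat.cast_nonneg k) hd
  funext x0
  have hbdd : BddAbove (Set.range fun x => |hhat1 x - hhat2 x|) :=
    ⟨C', by rintro _ ⟨x, rfl⟩; exact hbd x⟩
  obtain ⟨S, hS⟩ : ∃ S, S = ⨆ x, |hhat1 x - hhat2 x| := ⟨_, rfl⟩
  have hle : ∀ x, |hhat1 x - hhat2 x| ≤ S := fun x => hS ▸ le_ciSup hbdd x
  have hstep : ∀ x, |hhat1 x - hhat2 x| ≤ k * S / d := by
    intro x
    rw [le_div_iff₀ hd0]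
    calc |hhat1 x - hhat2 x| * d = |∑ i : Fin k, (hhat1 (f i x) - hhat2 (f i x))| := by
          rw [Finset.sum_sub_distrib, h1, h2, ← mul_sub, abs_mul, abs_of_pos hd0, mul_comm]
      _ ≤ ∑ i : Fin k, |hhat1 (f i x) - hhat2 (f i x)| := Finset.abs_sum_le_sum_abs _ _
      _ ≤ ∑ _i : Fin k, S := Finset.sum_le_sum fun i _ => hle _
      _ = k * S := by simp
  haveI : Nonempty X := ⟨x0⟩
  have hSle : S ≤ k * S / d := by
    conv_lhs => rw [hS]
    exact ciSup_le hstep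
  rw [le_div_iff₀ hd0] at hSle
  have hS0 : S ≤ 0 := by
    by_contra hpos
    push Not at hpos
    nlinarith
  exact sub_eq_zero.mp (abs_nonpos_iff.mp ((hle x0).trans hS0))
end

section
/- Suppose ĥ : X → ℝ satisfies ∑_{i=1}^k ĥ(fᵢ(x)) = d·ĥ(x) for all x ∈ X, and suppose ĥ is bounded below (there is c₀ ∈ ℝ with ĥ(x) ≥ c₀ for all x). Then ĥ(x) ≥ 0 for all x ∈ X. -/
/-- Proposition 1.3.1(1): a function satisfying the functional equation and bounded below
is nonnegative. -/
theorem canonical_height_nonneg {X : Type*} {k : ℕ} (hk : 1 ≤ k) (f : Fin k → X → X)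
    (d : ℝ) (hd : (k : ℝ) < d) (hhat : X → ℝ)
    (hfe : ∀ x : X, ∑ i : Fin k, hhat (f i x) = d * hhat x)
    (c₀ : ℝ) (hbelow : ∀ x : X, c₀ ≤ hhat x) :
    ∀ x : X, 0 ≤ hhat x := by
  intro x
  have hbdd : BddBelow (Set.range hhat) := ⟨c₀, by rintro _ ⟨y, rfl⟩; exact hbelow y⟩
  have hd0 : 0 < d := lt_of_le_of_lt (Nat.cast_nonneg k) hd
  haveI : Nonempty X := ⟨x⟩
  have hle : ∀ y, (⨅ z, hhat z) ≤ hhat y := fun y => ciInf_le hbdd y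
  have h1 : ∀ y, (k : ℝ) * (⨅ z, hhat z) / d ≤ hhat y := by
    intro y
    rw [div_le_iff₀ hd0, mul_comm (hhat y), ← hfe y]
    calc (k : ℝ) * (⨅ z, hhat z) = ∑ _i : Fin k, (⨅ z, hhat z) := by simp
      _ ≤ _ := Finset.sum_le_sum fun i _ => hle (f i y)
  have h2 : (k : ℝ) * (⨅ z, hhat z) / d ≤ ⨅ z, hhat z := le_ciInf h1
  rw [div_le_iff₀ hd0] at h2
  have h3 : 0 ≤ ⨅ z, hhat z := by
    by_contra! h
    nlinarith
  exact h3.trans (hle x)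
end

section
/- Suppose ĥ : X → ℝ satisfies ∑_{i=1}^k ĥ(fᵢ(x)) = d·ĥ(x) for all x ∈ X, and let x₀ ∈ X satisfy ĥ(x₀) > 0. Then for every l ∈ ℕ there exists a word w ∈ {1,…,k}ˡ such that ĥ(f_w(x₀)) ≥ (d/k)ˡ·ĥ(x₀). In particular, the forward orbit C(x₀) := { f_w(x₀) : w a word over {1,…,k} of any finite length } is an infinite set. -/
/-- The 'if' direction of Proposition 1.3.1(2): if `hhat x₀ > 0` then at every level `l` there
is a word `w` with `hhat(f_w x₀) ≥ (d/k)ˡ hhat x₀`, and the forward orbit of `x₀` is infinite. -/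
theorem orbit_infinite_of_height_pos {X : Type*} {k : ℕ} (hk : 1 ≤ k) (f : Fin k → X → X)
    (d : ℝ) (hd : (k : ℝ) < d) (hhat : X → ℝ)
    (hfe : ∀ x : X, ∑ i : Fin k, hhat (f i x) = d * hhat x)
    (x₀ : X) (hx₀ : 0 < hhat x₀) :
    (∀ l : ℕ, ∃ w : Fin l → Fin k,
      (d / (k : ℝ)) ^ l * hhat x₀ ≤ hhat (applyWord f (List.ofFn w) x₀)) ∧
    {y : X | ∃ w : List (Fin k), y = applyWord f w x₀}.Infinite := by
  have hk0 : (0 : ℝ) < k := by exact_mod_cast hk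
  have hr : 1 < d / (k : ℝ) := by rwa [one_lt_div hk0]
  have step : ∀ x : X, ∃ i : Fin k, d / (k : ℝ) * hhat x ≤ hhat (f i x) := by
    intro x
    by_contra! hcon
    have hlt : ∑ i : Fin k, hhat (f i x) < ∑ _i : Fin k, d / (k : ℝ) * hhat x :=
      Finset.sum_lt_sum_of_nonempty ⟨⟨0, hk⟩, Finset.mem_univ _⟩ (fun i _ => hcon i)
    rw [hfe x, Finset.sum_const, Finset.card_univ, Fintype.card_fin, nsmul_eq_mul] at hlt
    have he : (k : ℝ) * (d / (k : ℝ) * hhat x) = d * hhat x := by field_simp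
    linarith
  have main : ∀ l : ℕ, ∃ w : Fin l → Fin k,
      (d / (k : ℝ)) ^ l * hhat x₀ ≤ hhat (applyWord f (List.ofFn w) x₀) := by
    intro l
    induction l with
    | zero => exact ⟨Fin.elim0, by simp [applyWord]⟩
    | succ l ih =>
      obtain ⟨w, hw⟩ := ih
      obtain ⟨i, hi⟩ := step (applyWord f (List.ofFn w) x₀)
      refine ⟨Fin.cons i w, ?_⟩
      rw [List.ofFn_cons]
      refine le_trans ?_ hi
      rw [pow_succ', mul_assoc]
      exact mul_le_mul_of_nonneg_left hw (by linarith)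
  refine ⟨main, fun hfin => ?_⟩
  obtain ⟨B, hB⟩ := (hfin.image hhat).bddAbove
  obtain ⟨n, hn⟩ := pow_unbounded_of_one_lt (B / hhat x₀) hr
  obtain ⟨w, hw⟩ := main n
  have h1 : hhat (applyWord f (List.ofFn w) x₀) ≤ B := hB ⟨_, ⟨_, rfl⟩, rfl⟩
  rw [div_lt_iff₀ hx₀] at hn
  linarith
end

section
/- Suppose ĥ : X → ℝ satisfies ĥ(x) ≥ 0 and ∑_{i=1}^k ĥ(fᵢ(x)) = d·ĥ(x) for all x ∈ X. If x₀ ∈ X has finite forward orbit C(x₀) := { f_w(x₀) : w a word over {1,…,k} of any finite length }, then ĥ(x₀) = 0. -/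
/-- The 'only if' direction of Proposition 1.3.1(2): if the forward orbit of `x₀` is finite,
then the canonical height of `x₀` vanishes. -/
theorem height_zero_of_orbit_finite {X : Type*} {k : ℕ} (hk : 1 ≤ k) (f : Fin k → X → X)
    (d : ℝ) (hd : (k : ℝ) < d) (hhat : X → ℝ)
    (hnonneg : ∀ x : X, 0 ≤ hhat x)
    (hfe : ∀ x : X, ∑ i : Fin k, hhat (f i x) = d * hhat x)
    (x₀ : X) (horb : {y : X | ∃ w : List (Fin k), y = applyWord f w x₀}.Finite) :
    hhat x₀ = 0 := by
  obtain ⟨y, ⟨w, hw⟩, hmax⟩ := Set.exists_max_image _ hhat horb ⟨x₀, [], rfl⟩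
  have h0 : hhat x₀ ≤ hhat y := hmax x₀ ⟨[], rfl⟩
  have hs : ∑ i : Fin k, hhat (f i y) ≤ ∑ _i : Fin k, hhat y := by
    refine Finset.sum_le_sum fun i _ => hmax _ ⟨i :: w, ?_⟩
    rw [hw]
    rfl
  rw [hfe y] at hs
  simp only [Finset.sum_const, Finset.card_univ, Fintype.card_fin, nsmul_eq_mul] at hs
  have h1 := hnonneg x₀
  nlinarith [hnonneg y]
end

section
/- Let 𝔛 be a topological space, f₁, …, f_k : 𝔛 → 𝔛 continuous maps (k ≥ 1), γ : 𝔛 → ℝ a bounded continuous function, and d a real number with d > k. Then there exists a unique bounded continuous function γ̂ : 𝔛 → ℝ such that γ(x) = ∑_{i=1}^k γ̂(fᵢ(x)) − d·γ̂(x) for all x ∈ 𝔛. Moreover, this γ̂ satisfies ‖γ̂‖_sup ≤ ((2d+1)/(d−k))·‖γ‖_sup. -/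
theorem bcs_bound {𝔛 : Type*} [TopologicalSpace 𝔛] {k : ℕ}
    (f : Fin k → 𝔛 → 𝔛) (γ g : BoundedContinuousFunction 𝔛 ℝ) (d : ℝ) (hd : (k : ℝ) < d)
    (h : ∀ x : 𝔛, γ x = (∑ i : Fin k, g (f i x)) - d * g x) :
    (d - k) * ‖g‖ ≤ ‖γ‖ := by
  have hd0 : 0 < d := lt_of_le_of_lt (Nat.cast_nonneg k) hd
  have h1 : ‖g‖ ≤ (‖γ‖ + k * ‖g‖) / d := by
    rw [BoundedContinuousFunction.norm_le (by positivity)]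
    intro x
    rw [le_div_iff₀ hd0]
    have h2 : ‖∑ i : Fin k, g (f i x)‖ ≤ k * ‖g‖ := by
      refine (norm_sum_le _ _).trans ?_
      refine (Finset.sum_le_sum (fun i _ => g.norm_coe_le_norm (f i x))).trans ?_
      simp
    have h3 : d * g x = (∑ i : Fin k, g (f i x)) - γ x := by rw [h x]; ring
    have h4 : ‖g x‖ * d = ‖d * g x‖ := by
      rw [norm_mul, Real.norm_of_nonneg hd0.le, mul_comm]
    rw [h4, h3]
    have := norm_sub_le (∑ i : Fin k, g (f i x)) (γ x)
    have := γ.norm_coe_le_norm x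
    linarith
  rw [le_div_iff₀ hd0] at h1
  linarith

/-- Lemma 4.2.2: existence, uniqueness and norm bound for the bounded continuous solution `γ̂`
of `γ = ∑ᵢ γ̂ ∘ fᵢ − d·γ̂`. -/
theorem bounded_continuous_solution {𝔛 : Type*} [TopologicalSpace 𝔛] {k : ℕ} (hk : 1 ≤ k)
    (f : Fin k → 𝔛 → 𝔛) (hf : ∀ i, Continuous (f i))
    (γ : BoundedContinuousFunction 𝔛 ℝ) (d : ℝ) (hd : (k : ℝ) < d) :
    (∃! γhat : BoundedContinuousFunction 𝔛 ℝ,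
      ∀ x : 𝔛, γ x = (∑ i : Fin k, γhat (f i x)) - d * γhat x) ∧
    (∀ γhat : BoundedContinuousFunction 𝔛 ℝ,
      (∀ x : 𝔛, γ x = (∑ i : Fin k, γhat (f i x)) - d * γhat x) →
        ‖γhat‖ ≤ ((2 * d + 1) / (d - k)) * ‖γ‖) := by
  have hd0 : 0 < d := lt_of_le_of_lt (Nat.cast_nonneg k) hd
  have hdk : 0 < d - k := sub_pos.2 hd
  refine ⟨?_, ?_⟩
  · let T : BoundedContinuousFunction 𝔛 ℝ → BoundedContinuousFunction 𝔛 ℝ := fun g =>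
      d⁻¹ • ((∑ i : Fin k, g.compContinuous ⟨f i, hf i⟩) - γ)
    have hT : ∀ g x, T g x = d⁻¹ * ((∑ i : Fin k, g (f i x)) - γ x) := by
      intro g x
      simp [T, BoundedContinuousFunction.sum_apply]
    have hc : ContractingWith (Real.toNNReal (k / d)) T := by
      refine ⟨?_, ?_⟩
      · rw [Real.toNNReal_lt_one, div_lt_one hd0]
        exact hd
      · refine LipschitzWith.of_dist_le_mul fun g g' => ?_
        rw [Real.coe_toNNReal _ (by positivity),
          BoundedContinuousFunction.dist_le (by positivity)]
        intro x
        rw [hT, hT, Real.dist_eq, ← mul_sub, sub_sub_sub_cancel_right, ← Finset.sum_sub_distrib,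
          abs_mul, abs_of_pos (inv_pos.2 hd0), div_mul_eq_mul_div, div_eq_inv_mul]
        refine mul_le_mul_of_nonneg_left ?_ (inv_pos.2 hd0).le
        refine (Finset.abs_sum_le_sum_abs _ _).trans ?_
        refine (Finset.sum_le_sum
          (fun i _ => BoundedContinuousFunction.dist_coe_le_dist (f := g) (g := g') (f i x))).trans ?_
        simp
    have hp : T (ContractingWith.fixedPoint T hc) = ContractingWith.fixedPoint T hc :=
      hc.fixedPoint_isFixedPt
    have hu : ∀ g, T g = g → g = ContractingWith.fixedPoint T hc := fun g hg =>
      hc.fixedPoint_unique hg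
    generalize ContractingWith.fixedPoint T hc = p at hp hu
    clear_value T
    refine ⟨p, ?_, ?_⟩
    · intro x
      have h1 := hT p x
      rw [hp] at h1
      have h2 : d * p x = (∑ i : Fin k, p (f i x)) - γ x := by
        rw [h1, mul_inv_cancel_left₀ hd0.ne']
      linarith
    · intro g hg
      apply hu
      ext x
      rw [hT, hg x, sub_sub_cancel, inv_mul_cancel_left₀ hd0.ne']
  · intro g hg
    have h := bcs_bound f γ g d hd hg
    rw [div_mul_eq_mul_div, le_div_iff₀ hdk]
    nlinarith [norm_nonneg γ]
end

section
/- Let k and n be positive integers, let A = (a_{ij}) be a real n × n matrix with a_{ij} ≥ 0 for all i, j and ∑_{i=1}^n a_{ij} = k for every j, let ε > 0 and C be real numbers, and let h₁, …, h_n ∈ ℝ satisfy ∑_{i=1}^n a_{ij}·hᵢ ≥ (k+ε)·h_j − C for every j = 1, …, n. Then there exists an index α with h_α ≤ C/ε. -/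
/-- Key step of the Appendix Theorem: if the heights `h_j` of a finite orbit with incidence
matrix `A` satisfy `∑ᵢ a_{ij} hᵢ ≥ (k+ε) h_j − C`, then some `h_α ≤ C/ε`. -/
theorem exists_small_height (k n : ℕ) (hk : 0 < k) (hn : 0 < n)
    (A : Matrix (Fin n) (Fin n) ℝ) (hA : ∀ i j, 0 ≤ A i j)
    (hcol : ∀ j, ∑ i : Fin n, A i j = (k : ℝ))
    (ε C : ℝ) (hε : 0 < ε) (h : Fin n → ℝ)
    (hineq : ∀ j, ∑ i : Fin n, A i j * h i ≥ ((k : ℝ) + ε) * h j - C) :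
    ∃ α : Fin n, h α ≤ C / ε := by
  haveI : Nonempty (Fin n) := ⟨⟨0, hn⟩⟩
  obtain ⟨j, hj⟩ := Finite.exists_max h
  refine ⟨j, ?_⟩
  have h1 : ∑ i : Fin n, A i j * h i ≤ (k : ℝ) * h j := by
    rw [← hcol j, Finset.sum_mul]
    exact Finset.sum_le_sum fun i _ => mul_le_mul_of_nonneg_left (hj i) (hA i j)
  have h2 := hineq j
  rw [le_div_iff₀ hε]
  nlinarith
end

section
/- Let λ = 7 + 4√3. Let (s_n)_{n≥0} be a sequence of complex numbers converging to s_∞ ∈ ℂ. For n ∈ ℕ set t_{2n} := (1/4^{2n}) · ∑_{i=0}^n binom(2n, i) · λ^{n−i} · s_{n−i}. Then t_{2n} → s_∞ as n → ∞. -/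
lemma lam_sum (n : ℕ) :
    (∑ i ∈ Finset.range (n + 1), ((2 * n).choose i : ℝ) * (7 + 4 * Real.sqrt 3) ^ (n - i)) ≤ 16 ^ n ∧
    (16 : ℝ) ^ n - 4 ^ n ≤
      ∑ i ∈ Finset.range (n + 1), ((2 * n).choose i : ℝ) * (7 + 4 * Real.sqrt 3) ^ (n - i) := by
  have h3 : Real.sqrt 3 ^ 2 = 3 := Real.sq_sqrt (by norm_num)
  have h0 : 0 ≤ Real.sqrt 3 := Real.sqrt_nonneg 3
  have h2 : Real.sqrt 3 ≤ 2 := by nlinarith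
  have hν : 0 ≤ 2 - Real.sqrt 3 := by linarith
  have hμν : (2 - Real.sqrt 3) * (2 + Real.sqrt 3) = 1 := by nlinarith
  have hν1 : 2 - Real.sqrt 3 ≤ 1 := by nlinarith
  have hl : (7 + 4 * Real.sqrt 3) = (2 + Real.sqrt 3) ^ 2 := by nlinarith
  have key := add_pow (2 - Real.sqrt 3) (2 + Real.sqrt 3) (2 * n)
  have e4 : (2 - Real.sqrt 3) + (2 + Real.sqrt 3) = 4 := by ring
  rw [e4, pow_mul, show (4 : ℝ) ^ 2 = 16 by norm_num,
    show 2 * n + 1 = (n + 1) + n by ring, Finset.sum_range_add] at key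
  have e1 : ∑ i ∈ Finset.range (n + 1), (2 - Real.sqrt 3) ^ i * (2 + Real.sqrt 3) ^ (2 * n - i) *
      ((2 * n).choose i : ℝ) =
      ∑ i ∈ Finset.range (n + 1), ((2 * n).choose i : ℝ) * (7 + 4 * Real.sqrt 3) ^ (n - i) := by
    apply Finset.sum_congr rfl
    intro i hi
    have hi' : i ≤ n := by simpa [Nat.lt_succ_iff] using hi
    rw [hl, ← pow_mul, show 2 * n - i = i + 2 * (n - i) by omega, pow_add, ← mul_assoc,
      ← mul_pow, hμν]
    ring
  rw [e1] at key
  have e2 : 0 ≤ ∑ x ∈ Finset.range n, (2 - Real.sqrt 3) ^ (n + 1 + x) *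
      (2 + Real.sqrt 3) ^ (2 * n - (n + 1 + x)) * ((2 * n).choose (n + 1 + x) : ℝ) :=
    Finset.sum_nonneg fun i _ => by positivity
  have e3 : ∑ x ∈ Finset.range n, (2 - Real.sqrt 3) ^ (n + 1 + x) *
      (2 + Real.sqrt 3) ^ (2 * n - (n + 1 + x)) * ((2 * n).choose (n + 1 + x) : ℝ) ≤ 4 ^ n := by
    have hc : ∑ i ∈ Finset.range (2 * n + 1), ((2 * n).choose i : ℝ) = 4 ^ n := by
      have := Nat.sum_range_choose (2 * n)
      rw [pow_mul] at this
      exact_mod_cast this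
    rw [show 2 * n + 1 = (n + 1) + n by ring, Finset.sum_range_add] at hc
    rw [← hc]
    refine le_trans (Finset.sum_le_sum ?_) (le_add_of_nonneg_left
      (Finset.sum_nonneg fun i _ => by positivity))
    intro x hx
    have hx' : x < n := by simpa using hx
    have : (2 - Real.sqrt 3) ^ (n + 1 + x) * (2 + Real.sqrt 3) ^ (2 * n - (n + 1 + x)) ≤ 1 := by
      rw [show n + 1 + x = (2 * x + 2) + (2 * n - (n + 1 + x)) by omega, pow_add, mul_assoc,
        show 2 * n - (2 * x + 2 + (2 * n - (n + 1 + x))) = 2 * n - (n + 1 + x) by omega,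
        ← mul_pow, hμν]
      simpa using pow_le_one₀ hν hν1
    exact mul_le_of_le_one_left (by positivity) this
  constructor <;> linarith

/-- Claim in the proof of Proposition 3.3.4: with `λ = 7 + 4√3`, the averages
`t_{2n} = 4^{-2n} ∑_{i=0}^n C(2n,i) λ^{n-i} s_{n-i}` of a convergent sequence `s_n → s_∞`
converge to `s_∞`. -/
theorem binomial_average_tendsto (s : ℕ → ℂ) (sLim : ℂ)
    (hs : Filter.Tendsto s Filter.atTop (nhds sLim)) :
    Filter.Tendsto
      (fun n : ℕ => (1 / (4 : ℂ) ^ (2 * n)) *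
        ∑ i ∈ Finset.range (n + 1),
          ((2 * n).choose i : ℂ) * (((7 + 4 * Real.sqrt 3 : ℝ) : ℂ)) ^ (n - i) * s (n - i))
      Filter.atTop (nhds sLim) := by
  have hsum := lam_sum
  have hl1 : 1 ≤ 7 + 4 * Real.sqrt 3 := by linarith [Real.sqrt_nonneg 3]
  generalize 7 + 4 * Real.sqrt 3 = l at *
  have hl0 : 0 ≤ l := by linarith
  have hd : Filter.Tendsto (fun n => s n - sLim) Filter.atTop (nhds 0) := by
    simpa using hs.sub_const sLim
  obtain ⟨C, hC⟩ : ∃ C, ∀ j, ‖s j - sLim‖ ≤ C := by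
    obtain ⟨C, hC⟩ := (Metric.isBounded_range_of_tendsto _ hd).exists_norm_le
    exact ⟨C, fun j => hC _ ⟨j, rfl⟩⟩
  have hC0 : 0 ≤ C := (norm_nonneg _).trans (hC 0)
  rw [Metric.tendsto_atTop]
  intro ε hε
  obtain ⟨N, hN⟩ := Metric.tendsto_atTop.1 hs (ε / 2) (by positivity)
  have hpt : ∀ j, l ^ j * ‖s j - sLim‖ ≤ (ε / 2) * l ^ j + C * l ^ N := by
    intro j
    have hp : 0 ≤ l ^ j := by positivity
    have hq : 0 ≤ l ^ N := by positivity
    rcases le_total N j with h | h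
    · have := (hN j h).le
      rw [dist_eq_norm] at this
      nlinarith [mul_le_mul_of_nonneg_left this hp, mul_nonneg hC0 hq]
    · have h1 : l ^ j ≤ l ^ N := pow_le_pow_right₀ hl1 h
      have := mul_le_mul h1 (hC j) (norm_nonneg _) hq
      nlinarith [mul_nonneg hε.le hp]
  have hlim : Filter.Tendsto (fun n : ℕ => (C * l ^ N + ‖sLim‖) * (1 / 4 : ℝ) ^ n)
      Filter.atTop (nhds 0) := by
    simpa using (tendsto_pow_atTop_nhds_zero_of_lt_one (by norm_num : (0:ℝ) ≤ 1 / 4)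
      (by norm_num)).const_mul (C * l ^ N + ‖sLim‖)
  obtain ⟨M, hM⟩ := Filter.eventually_atTop.1 (hlim.eventually_lt_const (half_pos hε))
  refine ⟨M, fun n hn => ?_⟩
  have hMn := hM n hn
  obtain ⟨hA1, hA2⟩ := hsum n
  set A := ∑ i ∈ Finset.range (n + 1), ((2 * n).choose i : ℝ) * l ^ (n - i) with hA
  have h16 : (0 : ℝ) < 16 ^ n := by positivity
  have hE : ‖∑ i ∈ Finset.range (n + 1), ((2 * n).choose i : ℂ) * (l : ℂ) ^ (n - i) *
      (s (n - i) - sLim)‖ ≤ ε / 2 * A + C * l ^ N * 4 ^ n := by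
    have hc : ∑ i ∈ Finset.range (n + 1), ((2 * n).choose i : ℝ) ≤ 4 ^ n := by
      have := Nat.sum_range_choose (2 * n)
      rw [pow_mul] at this
      have h' : ∑ i ∈ Finset.range (2 * n + 1), ((2 * n).choose i : ℝ) = 4 ^ n := by
        exact_mod_cast this
      rw [← h']
      exact Finset.sum_le_sum_of_subset_of_nonneg
        (Finset.range_subset_range.2 (by omega)) (fun i _ _ => by positivity)
    calc _ ≤ ∑ i ∈ Finset.range (n + 1), ((ε / 2) * (((2 * n).choose i : ℝ) * l ^ (n - i)) +
            C * l ^ N * ((2 * n).choose i : ℝ)) := by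
          refine norm_sum_le_of_le _ fun i _ => ?_
          rw [norm_mul, norm_mul, norm_pow, Complex.norm_natCast, Complex.norm_real,
            Real.norm_of_nonneg hl0]
          have := mul_le_mul_of_nonneg_left (hpt (n - i)) (Nat.cast_nonneg (α := ℝ) ((2 * n).choose i))
          linarith
      _ = ε / 2 * A + C * l ^ N * ∑ i ∈ Finset.range (n + 1), ((2 * n).choose i : ℝ) := by
          rw [Finset.sum_add_distrib, ← Finset.mul_sum, ← Finset.mul_sum]
      _ ≤ _ := by gcongr
  have hid : (1 / (4 : ℂ) ^ (2 * n)) * ∑ i ∈ Finset.range (n + 1),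
          ((2 * n).choose i : ℂ) * (l : ℂ) ^ (n - i) * s (n - i) - sLim =
      (1 / (16 : ℂ) ^ n) * (∑ i ∈ Finset.range (n + 1), ((2 * n).choose i : ℂ) * (l : ℂ) ^ (n - i) *
      (s (n - i) - sLim) + ((A - 16 ^ n : ℝ) : ℂ) * sLim) := by
    rw [pow_mul, show (4 : ℂ) ^ 2 = 16 by norm_num]
    simp only [mul_sub, Finset.sum_sub_distrib, ← Finset.sum_mul]
    rw [hA]
    push_cast
    field_simp
    ring
  rw [dist_eq_norm, hid, norm_mul]
  have hn16 : ‖1 / (16 : ℂ) ^ n‖ = 1 / 16 ^ n := by simp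
  have hB : ‖((A - 16 ^ n : ℝ) : ℂ) * sLim‖ ≤ 4 ^ n * ‖sLim‖ := by
    rw [norm_mul, Complex.norm_real, Real.norm_eq_abs]
    gcongr
    have : (0 : ℝ) < 4 ^ n := by positivity
    rw [abs_le]; constructor <;> linarith
  rw [hn16, one_div, inv_mul_lt_iff₀ h16]
  have h4 : (1 / 4 : ℝ) ^ n * 16 ^ n = 4 ^ n := by rw [← mul_pow]; norm_num
  have h5 := mul_lt_mul_of_pos_right hMn h16
  rw [mul_assoc, h4] at h5
  have h6 := mul_le_mul_of_nonneg_left hA1 (half_pos hε).le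
  have := norm_add_le (∑ i ∈ Finset.range (n + 1), ((2 * n).choose i : ℂ) * (l : ℂ) ^ (n - i) *
      (s (n - i) - sLim)) (((A - 16 ^ n : ℝ) : ℂ) * sLim)
  linarith
end

section
/- Suppose H : X → ℝ satisfies m ≤ H(x) ≤ M for all x ∈ X, where 0 < m ≤ M are real constants. For n ∈ ℕ define H_n : X → ℝ by H_n(x) := ∏_{l=0}^{n−1} ∏_{w ∈ {1,…,k}ˡ} H(f_w(x))^{1/dˡ} (real exponents). Then the sequence (H_n) converges uniformly on X: there is a function H_∞ : X → ℝ such that sup_{x∈X} |H_n(x) − H_∞(x)| → 0 as n → ∞. Moreover H_∞(x) ≥ (min(m,1))^{d/(d−k)} > 0 for all x ∈ X. -/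
/-- `Hseq f d H n x = ∏_{l=0}^{n-1} ∏_{w ∈ {1,…,k}ˡ} H(f_w x)^{1/dˡ}` (real exponents). -/
noncomputable def Hseq {X : Type*} {k : ℕ} (f : Fin k → X → X) (d : ℝ) (H : X → ℝ)
    (n : ℕ) (x : X) : ℝ :=
  ∏ l ∈ Finset.range n, ∏ w : Fin l → Fin k,
    H (applyWord f (List.ofFn w) x) ^ (1 / d ^ l : ℝ)

/-- Convergence claim in the proof of Theorem 3.1.1: the products `H_n` converge uniformly
to a function `H_∞` bounded below by `min(m,1)^{d/(d-k)} > 0`. -/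
theorem Hseq_tendstoUniformly {X : Type*} {k : ℕ} (hk : 1 ≤ k) (f : Fin k → X → X)
    (d : ℝ) (hd : (k : ℝ) < d) (H : X → ℝ) (m M : ℝ) (hm : 0 < m) (hmM : m ≤ M)
    (hH : ∀ x : X, m ≤ H x ∧ H x ≤ M) :
    ∃ Hinf : X → ℝ,
      TendstoUniformly (fun n => Hseq f d H n) Hinf Filter.atTop ∧
      (∀ x : X, (min m 1) ^ (d / (d - k)) ≤ Hinf x) ∧
      (0 : ℝ) < (min m 1) ^ (d / (d - k)) := by
  have hk1 : (1 : ℝ) ≤ k := by exact_mod_cast hk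
  have hd0 : 0 < d := by linarith
  have hr0 : 0 ≤ (k : ℝ) / d := by positivity
  have hr1 : (k : ℝ) / d < 1 := by rw [div_lt_one hd0]; exact hd
  have hmin : 0 < min m 1 := lt_min hm one_pos
  have hpos : ∀ x, 0 < H x := fun x => lt_of_lt_of_le hm (hH x).1
  set C : ℝ := max |Real.log m| |Real.log M| with hC
  have hC0 : 0 ≤ C := le_trans (abs_nonneg _) (le_max_left _ _)
  have hlog : ∀ x, |Real.log (H x)| ≤ C := by
    intro x
    have h1 := Real.log_le_log hm (hH x).1
    have h2 := Real.log_le_log (hpos x) (hH x).2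
    exact abs_le_max_abs_abs h1 h2
  let g : ℕ → X → ℝ := fun l x => ∑ w : Fin l → Fin k,
    Real.log (H (applyWord f (List.ofFn w) x)) * (1 / d ^ l : ℝ)
  have hcard : ∀ (l : ℕ) (c : ℝ), ∑ _w : Fin l → Fin k, c * (1 / d ^ l : ℝ)
      = c * ((k : ℝ) / d) ^ l := by
    intro l c
    simp [div_pow]
    ring
  have hexp : ∀ n x, Hseq f d H n x = Real.exp (∑ l ∈ Finset.range n, g l x) := by
    intro n x
    simp only [Hseq, g, Real.exp_sum]
    refine Finset.prod_congr rfl fun l _ => Finset.prod_congr rfl fun w _ => ?_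
    rw [Real.rpow_def_of_pos (hpos _)]
  have hg : ∀ l x, ‖g l x‖ ≤ C * ((k : ℝ) / d) ^ l := by
    intro l x
    rw [← hcard l C]
    refine norm_sum_le_of_le _ fun w _ => ?_
    rw [norm_mul, Real.norm_eq_abs, Real.norm_eq_abs,
      abs_of_nonneg (by positivity : (0 : ℝ) ≤ 1 / d ^ l)]
    exact mul_le_mul_of_nonneg_right (hlog _) (by positivity)
  have hgeo := hasSum_geometric_of_lt_one hr0 hr1
  have hsumC : Summable fun l => C * ((k : ℝ) / d) ^ l := hgeo.summable.mul_left C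
  have hT := tendstoUniformly_tsum_nat hsumC hg
  have hsg : ∀ x, Summable fun l => g l x := fun x =>
    Summable.of_norm_bounded hsumC fun l => hg l x
  set B : ℝ := ∑' l, C * ((k : ℝ) / d) ^ l with hB
  have hpart : ∀ n x, ∑ l ∈ Finset.range n, g l x ∈ Set.Icc (-B) B := by
    intro n x
    rw [Set.mem_Icc, ← abs_le, ← Real.norm_eq_abs]
    exact (norm_sum_le_of_le _ fun l _ => hg l x).trans
      (hsumC.sum_le_tsum _ fun l _ => by positivity)
  have hlim : ∀ x, ∑' l, g l x ∈ Set.Icc (-B) B := fun x =>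
    isClosed_Icc.mem_of_tendsto (hsg x).hasSum.tendsto_sum_nat
      (Filter.Eventually.of_forall fun n => hpart n x)
  have huc : UniformContinuousOn Real.exp (Set.Icc (-B) B) :=
    isCompact_Icc.uniformContinuousOn_of_continuous Real.continuous_exp.continuousOn
  refine ⟨fun x => Real.exp (∑' l, g l x), ?_, ?_, Real.rpow_pos_of_pos hmin _⟩
  · have := UniformContinuousOn.comp_tendstoUniformly hpart hlim huc hT
    have he : (fun n => Hseq f d H n) =
        fun n => Real.exp ∘ fun x => ∑ l ∈ Finset.range n, g l x := by
      funext n x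
      exact hexp n x
    rw [he]
    exact this
  · intro x
    rw [Real.rpow_def_of_pos hmin]
    refine Real.exp_le_exp.2 ?_
    have h1 := hgeo.mul_left (Real.log (min m 1))
    have h2 : (1 - (k : ℝ) / d)⁻¹ = d / (d - k) := by
      have : d - k ≠ 0 := by linarith
      field_simp
    rw [h2] at h1
    refine hasSum_le (fun l => ?_) h1 (hsg x).hasSum
    rw [← hcard]
    refine Finset.sum_le_sum fun w _ => mul_le_mul_of_nonneg_right ?_ (by positivity)
    exact Real.log_le_log hmin ((min_le_left _ _).trans (hH _).1)
end

section
/- Suppose H : X → ℝ satisfies m ≤ H(x) ≤ M for all x ∈ X, where 0 < m ≤ M are real constants. For n ∈ ℕ define H_n : X → ℝ by H_n(x) := ∏_{l=0}^{n−1} ∏_{w ∈ {1,…,k}ˡ} H(f_w(x))^{1/dˡ} (real exponents), and suppose H_∞ : X → ℝ is a pointwise limit of (H_n), i.e. H_n(x) → H_∞(x) for every x ∈ X. Then H_∞ satisfies the functional equation H_∞(x)^d = H(x)^d · ∏_{i=1}^k H_∞(fᵢ(x)) for all x ∈ X. -/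
theorem applyWord_concat {X : Type*} {k : ℕ} (f : Fin k → X → X) (w : List (Fin k)) (i : Fin k)
    (x : X) : applyWord f (w ++ [i]) x = applyWord f w (f i x) := by
  induction w with
  | nil => rfl
  | cons a w ih => simp only [List.cons_append, applyWord, ih]

theorem prod_words_succ {k l : ℕ} (F : List (Fin k) → ℝ) :
    ∏ w : Fin (l + 1) → Fin k, F (List.ofFn w)
      = ∏ i : Fin k, ∏ w : Fin l → Fin k, F (List.ofFn w ++ [i]) := by
  rw [← Fintype.prod_prod_type', ← (Fin.snocEquiv (fun _ : Fin (l + 1) => Fin k)).prod_comp]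
  refine Finset.prod_congr rfl fun p _ => ?_
  congr 1
  rw [List.ofFn_succ']
  simp [Fin.snocEquiv, List.concat_eq_append]

theorem Hseq_succ_rpow {X : Type*} {k : ℕ} (f : Fin k → X → X) (d : ℝ) (hd : 0 < d) (H : X → ℝ)
    (hH : ∀ x, 0 < H x) (n : ℕ) (x : X) :
    Hseq f d H (n + 1) x ^ d = H x ^ d * ∏ i : Fin k, Hseq f d H n (f i x) := by
  unfold Hseq
  rw [Finset.prod_range_succ', Finset.prod_comm, mul_comm, Real.mul_rpow
    (Finset.prod_nonneg fun _ _ => (Real.rpow_pos_of_pos (hH _) _).le)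
    (Finset.prod_nonneg fun _ _ => Finset.prod_nonneg fun _ _ =>
      (Real.rpow_pos_of_pos (hH _) _).le)]
  congr 1
  · simp [applyWord]
  · rw [← Real.finsetProd_rpow _ _ (fun _ _ => Finset.prod_nonneg fun _ _ =>
      (Real.rpow_pos_of_pos (hH _) _).le)]
    refine Finset.prod_congr rfl fun l _ => ?_
    rw [← Real.finsetProd_rpow _ _ (fun _ _ => (Real.rpow_pos_of_pos (hH _) _).le)]
    rw [prod_words_succ (fun w => (H (applyWord f w x) ^ (1 / d ^ (l + 1) : ℝ)) ^ d)]
    refine Finset.prod_congr rfl fun i _ => Finset.prod_congr rfl fun w _ => ?_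
    rw [applyWord_concat, ← Real.rpow_mul (hH _).le]
    congr 1
    field_simp
    ring

/-- Theorem 3.1.1(2) (abstract form): a pointwise limit `H_∞` of the `H_n` satisfies the
functional equation `H_∞(x)^d = H(x)^d · ∏ᵢ H_∞(fᵢ x)`. -/
theorem Hinf_functional_equation {X : Type*} {k : ℕ} (hk : 1 ≤ k) (f : Fin k → X → X)
    (d : ℝ) (hd : (k : ℝ) < d) (H : X → ℝ) (m M : ℝ) (hm : 0 < m) (hmM : m ≤ M)
    (hH : ∀ x : X, m ≤ H x ∧ H x ≤ M) (Hinf : X → ℝ)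
    (hlim : ∀ x : X, Filter.Tendsto (fun n => Hseq f d H n x) Filter.atTop (nhds (Hinf x))) :
    ∀ x : X, Hinf x ^ d = H x ^ d * ∏ i : Fin k, Hinf (f i x) := by
  intro x
  have hd0 : 0 < d := lt_of_le_of_lt (Nat.cast_nonneg k) hd
  have h1 := ((hlim x).comp (Filter.tendsto_add_atTop_nat 1)).rpow_const (p := d) (Or.inr hd0.le)
  have h2 := (tendsto_finsetProd (Finset.univ : Finset (Fin k))
    (fun i _ => hlim (f i x))).const_mul (H x ^ d)
  refine tendsto_nhds_unique h1 (h2.congr fun n => ?_)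
  exact (Hseq_succ_rpow f d hd0 H (fun y => hm.trans_le (hH y).1) n x).symm
end

section
/- Suppose A : X → ℝ satisfies: there exist real numbers m, M with 0 < m ≤ A(x) ≤ M for all x ∈ X, and A(x)^d = ∏_{i=1}^k A(fᵢ(x)) for all x ∈ X (real power). Then A(x) = 1 for all x ∈ X. -/
/-- Uniqueness assertion in Theorem 3.1.1(2): a function `A` bounded between positive constants
satisfying `A(x)^d = ∏ᵢ A(fᵢ x)` is identically `1`. -/
theorem quotient_identically_one {X : Type*} {k : ℕ} (hk : 1 ≤ k) (f : Fin k → X → X)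
    (d : ℝ) (hd : (k : ℝ) < d) (A : X → ℝ) (m M : ℝ) (hm : 0 < m)
    (hbd : ∀ x : X, m ≤ A x ∧ A x ≤ M)
    (hfe : ∀ x : X, A x ^ d = ∏ i : Fin k, A (f i x)) :
    ∀ x : X, A x = 1 := by
  have hpos : ∀ x, 0 < A x := fun x => lt_of_lt_of_le hm (hbd x).1
  have hL : ∀ x, d * Real.log (A x) = ∑ i : Fin k, Real.log (A (f i x)) := by
    intro x
    rw [← Real.log_rpow (hpos x), hfe x, Real.log_prod (fun i _ => (hpos _).ne')]
  have hk0 : (0 : ℝ) ≤ k := Nat.cast_nonneg k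
  have hd0 : 0 < d := lt_of_le_of_lt hk0 hd
  have hB : BddAbove (Set.range fun x => |Real.log (A x)|) := by
    refine ⟨max |Real.log m| |Real.log M|, ?_⟩
    rintro _ ⟨x, rfl⟩
    exact abs_le_max_abs_abs (Real.log_le_log hm (hbd x).1) (Real.log_le_log (hpos x) (hbd x).2)
  intro x
  have : Nonempty X := ⟨x⟩
  set S := ⨆ x, |Real.log (A x)| with hS
  have hle : ∀ y, |Real.log (A y)| ≤ S := fun y => le_ciSup hB y
  have h1 : ∀ y, |Real.log (A y)| ≤ k * S / d := by
    intro y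
    rw [le_div_iff₀ hd0, mul_comm]
    calc d * |Real.log (A y)| = |d * Real.log (A y)| := by rw [abs_mul, abs_of_pos hd0]
      _ = |∑ i : Fin k, Real.log (A (f i y))| := by rw [hL]
      _ ≤ ∑ i : Fin k, |Real.log (A (f i y))| := Finset.abs_sum_le_sum_abs _ _
      _ ≤ ∑ _i : Fin k, S := Finset.sum_le_sum fun i _ => hle _
      _ = k * S := by simp
  have h2 : S ≤ k * S / d := ciSup_le h1
  rw [le_div_iff₀ hd0] at h2
  have h3 : S ≤ 0 := by nlinarith
  have h4 : Real.log (A x) = 0 := abs_nonpos_iff.mp ((hle x).trans h3)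
  exact Real.eq_one_of_pos_of_log_eq_zero (hpos x) h4
end
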